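/- arXiv:1410.8780 — 2 statements merged into one kernel-verified Lean document; each statement's English description precedes it below -/
import Mathlib

section
/- Green's relations L and R are congruences on any skew Heyting algebra (S;∧,∨,→,1): if a L c and b L d then (a→b) L (c→d), and if a R c and b R d then (a→b) R (c→d). -/
/-- A skew lattice: both operations idempotent, associative, with the four absorption laws. -/
structure SkewLattice (S : Type*) where
  m : S → S → S  -- meet ∧
  j : S → S → S  -- join ∨
  m_idem : ∀ x, m x x = x
  j_idem : ∀ x, j x x = x
  m_assoc : ∀ x y z, m (m x y) z = m x (m y z)
  j_assoc : ∀ x y z, j (j x y) z = j x (j y z)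
  abs1 : ∀ x y, m x (j x y) = x
  abs2 : ∀ x y, j x (m x y) = x
  abs3 : ∀ x y, j (m x y) y = y
  abs4 : ∀ x y, m (j x y) y = y

namespace SkewLattice

variable {S : Type*}

/-- Natural partial order: x ≤ y iff x∨y = y = y∨x. -/
def nle (L : SkewLattice S) (x y : S) : Prop := L.j x y = y ∧ L.j y x = y

/-- Natural preorder: x ⪯ y iff y∨x∨y = y. -/
def npre (L : SkewLattice S) (x y : S) : Prop := L.j (L.j y x) y = y

/-- Green's relation D: x D y iff x ⪯ y and y ⪯ x. -/
def dRel (L : SkewLattice S) (x y : S) : Prop := L.npre x y ∧ L.npre y x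

/-- Green's relation L. -/
def lRel (L : SkewLattice S) (x y : S) : Prop := L.m x y = x ∧ L.m y x = y

/-- Green's relation R. -/
def rRel (L : SkewLattice S) (x y : S) : Prop := L.m x y = y ∧ L.m y x = x

/-- Co-strong distributivity. -/
def CoStronglyDistributive (L : SkewLattice S) : Prop :=
  (∀ x y z, L.j x (L.m y z) = L.m (L.j x y) (L.j x z)) ∧
  (∀ x y z, L.j (L.m x y) z = L.m (L.j x z) (L.j y z))

/-- Conormality: x∨y∨z∨w = x∨z∨y∨w. -/
def Conormal (L : SkewLattice S) : Prop :=
  ∀ x y z w, L.j (L.j (L.j x y) z) w = L.j (L.j (L.j x z) y) w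

/-- t is a top: x∨t = t = t∨x for all x. -/
def IsTop (L : SkewLattice S) (t : S) : Prop := ∀ x, L.j x t = t ∧ L.j t x = t

/-- `h` is a skew Heyting implication for the skew lattice `L`:
(i) x→y = (y∨x∨y)→y, and (ii) whenever y ≤ x, x→y is the greatest element w
of the upset y↑ satisfying w∧x ≤ y. -/
def IsSkewHeytingImp (L : SkewLattice S) (h : S → S → S) : Prop :=
  (∀ x y, h x y = h (L.j (L.j y x) y) y) ∧
  (∀ x y, L.nle y x →
     L.nle y (h x y) ∧ L.nle (L.m (h x y) x) y ∧
     ∀ w, L.nle y w → L.nle (L.m w x) y → L.nle w (h x y))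

end SkewLattice

open SkewLattice

/-- A skew Heyting algebra: a co-strongly distributive skew lattice with top 1 together
with an implication satisfying (i) and (ii) above. -/
structure SkewHeytingAlgebra (S : Type*) extends SkewLattice S where
  himp : S → S → S
  one : S
  costrong : toSkewLattice.CoStronglyDistributive
  top : toSkewLattice.IsTop one
  himp_spec : toSkewLattice.IsSkewHeytingImp himp

namespace SkewLattice

variable {S : Type*} {L : SkewLattice S}

theorem nle_antisymm {x y : S} (hxy : L.nle x y) (hyx : L.nle y x) : x = y :=
  hyx.2.symm.trans hxy.1

theorem nle_sandwich (d x : S) : L.nle d (L.j (L.j d x) d) := by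
  refine ⟨?_, ?_⟩
  · rw [← L.j_assoc, ← L.j_assoc, L.j_idem]
  · rw [L.j_assoc, L.j_idem]

theorem sandwich_eq_self {d x : S} (h : L.nle d x) : L.j (L.j d x) d = x := by
  rw [h.1, h.2]

/-- Upsets of the natural order are commutative in a co-strongly distributive skew lattice. -/
theorem CoStronglyDistributive.j_comm_of_nle (hL : L.CoStronglyDistributive) {u p q : S}
    (hp : L.nle u p) (hq : L.nle u q) : L.j p q = L.j q p := by
  have hup : L.m u p = u := by rw [← hp.1, L.abs1]
  have hqpq : L.m q (L.j p q) = q := by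
    have h := hL.2 u p q
    rwa [hup, hq.1, eq_comm] at h
  have h₁ : L.j q (L.j p q) = L.j p q := by
    have h := L.abs3 q (L.j p q)
    rwa [hqpq] at h
  have hpq : L.m (L.j q p) q = q := by
    have hpu : L.m p u = u := by rw [← hp.2, L.abs4]
    have h := hL.1 q p u
    rwa [hpu, hq.2, eq_comm] at h
  have h₂ : L.j (L.j q p) q = L.j q p := by
    have h := L.abs2 (L.j q p) q
    rwa [hpq] at h
  rw [← h₁, ← L.j_assoc, h₂]

/-- If `y` and `z` lie below `f` in the natural preorder, then so does `y ∨ z`. -/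
theorem npre_j {f y z : S} (hy : L.npre y f) (hz : L.npre z f) : L.npre (L.j y z) f := by
  unfold npre at *
  have h := congrArg (fun t => L.j (L.j f t) f) (L.j_idem (L.j (L.j z f) y))
  calc L.j (L.j f (L.j y z)) f
      = L.j (L.j (L.j (L.j f z) f) (L.j y z)) (L.j (L.j f y) f) := by rw [hy, hz]
    _ = L.j (L.j f (L.j (L.j (L.j z f) y) (L.j (L.j z f) y))) f := by simp only [L.j_assoc]
    _ = L.j (L.j f (L.j (L.j z f) y)) f := h
    _ = L.j (L.j (L.j f z) f) (L.j y f) := by simp only [L.j_assoc]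
    _ = f := by rw [hz, ← L.j_assoc, hy]

theorem j_self_left (x y : S) : L.j x (L.j x y) = L.j x y := by
  rw [← L.j_assoc, L.j_idem]

theorem j_j_self_left (x y z : S) : L.j x (L.j y (L.j x (L.j y z))) = L.j x (L.j y z) := by
  have h := congrArg (L.j · z) (L.j_idem (L.j x y))
  simpa only [L.j_assoc] using h

/-- The map `x ↦ d ∨ x ∨ d` preserves joins in a co-strongly distributive skew lattice. -/
theorem CoStronglyDistributive.sandwich_j (hL : L.CoStronglyDistributive) (x y z : S) :
    L.j (L.j x (L.j y z)) x = L.j (L.j (L.j x y) x) (L.j (L.j x z) x) := by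
  have hxp := nle_sandwich (L := L) x y
  have hxq := nle_sandwich (L := L) x z
  have hxe := nle_sandwich (L := L) x (L.j y z)
  generalize hp : L.j (L.j x y) x = p at *
  generalize hq : L.j (L.j x z) x = q at *
  generalize he : L.j (L.j x (L.j y z)) x = e at *
  have hpe : L.j p e = e := by
    simp only [← hp, ← he, L.j_assoc, j_self_left, j_j_self_left]
  have heq : L.j e q = e := by
    have h := L.j_idem (L.j z x)
    simp only [L.j_assoc] at h
    simp only [← hq, ← he, L.j_assoc, j_self_left, h]
  have hpq := hL.j_comm_of_nle hxp hxq
  have hxf : L.nle x (L.j p q) :=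
    ⟨by rw [← L.j_assoc, hxp.1], by rw [L.j_assoc, hxq.2]⟩
  have absorb (t : S) :
      L.j (L.j (L.j p q) t) (L.j p q) = L.j (L.j p q) (L.j (L.j (L.j x t) x) (L.j p q)) := by
    calc L.j (L.j (L.j p q) t) (L.j p q)
        = L.j (L.j (L.j (L.j p q) x) t) (L.j x (L.j p q)) := by rw [hxf.1, hxf.2]
      _ = _ := by simp only [L.j_assoc]
  have hy : L.npre y (L.j p q) := by
    change L.j (L.j (L.j p q) y) (L.j p q) = _
    rw [absorb, hp, ← L.j_assoc p, L.j_idem, L.j_idem]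
  have hz : L.npre z (L.j p q) := by
    change L.j (L.j (L.j p q) z) (L.j p q) = _
    rw [absorb, hq, hpq, ← L.j_assoc q, L.j_idem, L.j_idem]
  have hyz : L.j (L.j p q) (L.j e (L.j p q)) = L.j p q := by
    rw [← he, ← absorb]
    exact npre_j hy hz
  have hef : L.j e (L.j p q) = e := by
    rw [← L.j_assoc, hL.j_comm_of_nle hxe hxp, hpe, heq]
  have hfe : L.j (L.j p q) e = e := by
    rw [← hL.j_comm_of_nle hxe hxf, hef]
  rw [hef, hfe] at hyz
  exact hyz

theorem CoStronglyDistributive.sandwich_mono (hL : L.CoStronglyDistributive) (d : S) {x y : S}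
    (h : L.nle x y) : L.nle (L.j (L.j d x) d) (L.j (L.j d y) d) := by
  refine ⟨?_, ?_⟩
  · rw [← hL.sandwich_j, h.1]
  · rw [← hL.sandwich_j, h.2]

theorem CoStronglyDistributive.sandwich_m (hL : L.CoStronglyDistributive) (d x y : S) :
    L.j (L.j d (L.m x y)) d = L.m (L.j (L.j d x) d) (L.j (L.j d y) d) := by
  rw [hL.1, hL.2]

theorem CoStronglyDistributive.sandwich_sandwich (hL : L.CoStronglyDistributive) {b d : S}
    (h : L.npre b d) (x : S) :
    L.j (L.j d (L.j (L.j b x) b)) d = L.j (L.j d x) d := by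
  rw [hL.sandwich_j, hL.sandwich_j, show L.j (L.j d b) d = d from h,
    (nle_sandwich d x).1, (nle_sandwich d x).2]

theorem CoStronglyDistributive.sandwich_eq_of_dRel (hL : L.CoStronglyDistributive) {a c : S}
    (h : L.dRel a c) (d : S) : L.j (L.j d a) d = L.j (L.j d c) d := by
  have key {x y : S} (hxy : L.npre x y) :
      L.j (L.j (L.j d x) d) (L.j (L.j d y) d) = L.j (L.j d y) d := by
    have h : L.j (L.j (L.j (L.j d y) d) (L.j (L.j d x) d)) (L.j (L.j d y) d)
        = L.j (L.j d y) d := by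
      rw [← hL.sandwich_j, ← hL.sandwich_j, show L.j (L.j y x) y = y from hxy]
    rwa [hL.j_comm_of_nle (nle_sandwich d y) (nle_sandwich d x), L.j_assoc, L.j_idem] at h
  rw [← key h.2, hL.j_comm_of_nle (nle_sandwich d c) (nle_sandwich d a), key h.1]

theorem lRel.j_left {x y : S} (h : L.lRel x y) : L.j x y = y := by
  rw [← h.1, L.abs3]

theorem rRel.j_left {x y : S} (h : L.rRel x y) : L.j x y = x := by
  rw [← h.1, L.abs2]

theorem lRel.symm {x y : S} (h : L.lRel x y) : L.lRel y x := ⟨h.2, h.1⟩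

theorem rRel.symm {x y : S} (h : L.rRel x y) : L.rRel y x := ⟨h.2, h.1⟩

theorem lRel.dRel {x y : S} (h : L.lRel x y) : L.dRel x y := by
  refine ⟨?_, ?_⟩ <;> unfold npre
  · rw [h.symm.j_left, h.j_left]
  · rw [h.j_left, h.symm.j_left]

theorem rRel.dRel {x y : S} (h : L.rRel x y) : L.dRel x y := by
  refine ⟨?_, ?_⟩ <;> unfold npre
  · rw [h.symm.j_left, L.j_idem]
  · rw [h.j_left, L.j_idem]

theorem lRel.sandwich {b d w : S} (h : L.lRel b d) (hw : L.nle b w) :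
    L.lRel w (L.j (L.j d w) d) := by
  have hdw : L.j d w = w := by
    rw [← hw.1, ← L.j_assoc, h.symm.j_left]
  rw [hdw]
  refine ⟨L.abs1 w d, ?_⟩
  have hv : L.j (L.j w d) w = w := by rw [L.j_assoc, hdw, L.j_idem]
  have h := L.abs1 (L.j w d) w
  rwa [hv] at h

theorem rRel.sandwich {b d w : S} (h : L.rRel b d) (hw : L.nle b w) :
    L.rRel w (L.j (L.j d w) d) := by
  have hwd : L.j w d = w := by
    rw [← hw.2, L.j_assoc, h.j_left]
  rw [L.j_assoc, hwd]
  refine ⟨?_, L.abs4 d w⟩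
  have hv : L.j w (L.j d w) = w := by rw [← L.j_assoc, hwd, L.j_idem]
  have h := L.abs4 w (L.j d w)
  rwa [hv] at h

end SkewLattice

namespace SkewHeytingAlgebra

variable {S : Type*} (A : SkewHeytingAlgebra S)

theorem nle_himp (a b : S) : A.nle b (A.himp a b) := by
  rw [A.himp_spec.1]
  exact (A.himp_spec.2 _ _ (nle_sandwich b a)).1

theorem himp_m_nle (a b : S) : A.nle (A.m (A.himp a b) (A.j (A.j b a) b)) b := by
  rw [A.himp_spec.1]
  exact (A.himp_spec.2 _ _ (nle_sandwich b a)).2.1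

theorem nle_himp_of_m_nle {a b w : S} (hw : A.nle b w)
    (h : A.nle (A.m w (A.j (A.j b a) b)) b) : A.nle w (A.himp a b) := by
  rw [A.himp_spec.1]
  exact (A.himp_spec.2 _ _ (nle_sandwich b a)).2.2 w hw h

theorem sandwich_himp_nle {a b c d : S} (hac : A.dRel a c) (hbd : A.dRel b d) :
    A.nle (A.j (A.j d (A.himp a b)) d) (A.himp c d) := by
  refine A.nle_himp_of_m_nle (nle_sandwich _ _) ?_
  rw [← A.costrong.sandwich_eq_of_dRel hac d, ← A.costrong.sandwich_sandwich hbd.1 a,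
    ← A.costrong.sandwich_m]
  have h := A.costrong.sandwich_mono d (A.himp_m_nle a b)
  rwa [show A.j (A.j d b) d = d from hbd.1] at h

/-- Replacing the arguments by `D`-related ones transports the implication along the
isomorphism `w ↦ d ∨ w ∨ d` of upsets. -/
theorem himp_eq_sandwich {a b c d : S} (hac : A.dRel a c) (hbd : A.dRel b d) :
    A.himp c d = A.j (A.j d (A.himp a b)) d := by
  refine nle_antisymm ?_ (A.sandwich_himp_nle hac hbd)
  have h := A.costrong.sandwich_mono d (A.sandwich_himp_nle ⟨hac.2, hac.1⟩ ⟨hbd.2, hbd.1⟩)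
  rwa [A.costrong.sandwich_sandwich hbd.1, sandwich_eq_self (A.nle_himp c d)] at h

end SkewHeytingAlgebra

/-- Green's relations L and R are congruences for → on any skew
Heyting algebra. -/
theorem stmt_13 {S : Type*} (A : SkewHeytingAlgebra S) (a b c d : S) :
    (A.toSkewLattice.lRel a c → A.toSkewLattice.lRel b d →
      A.toSkewLattice.lRel (A.himp a b) (A.himp c d)) ∧
    (A.toSkewLattice.rRel a c → A.toSkewLattice.rRel b d →
      A.toSkewLattice.rRel (A.himp a b) (A.himp c d)) := by
  refine ⟨fun hac hbd => ?_, fun hac hbd => ?_⟩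
  · rw [A.himp_eq_sandwich hac.dRel hbd.dRel]
    exact hbd.sandwich (A.nle_himp a b)
  · rw [A.himp_eq_sandwich hac.dRel hbd.dRel]
    exact hbd.sandwich (A.nle_himp a b)
end

section
/- Let (S;∧,∨,1) be a co-strongly distributive skew lattice with top 1 that is a skew chain, i.e. the natural preorder ⪯ is total (for all x, y, either x ⪯ y or y ⪯ x). Define x→y = 1 if x ⪯ y and x→y = y otherwise. Then (S;∧,∨,→,1) is a skew Heyting algebra. -/
open SkewLattice

namespace SkewLattice

variable {S : Type*} (L : SkewLattice S) {x y : S}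

theorem npre.meet_meet_eq (h : L.npre x y) : L.m (L.m x y) x = x := by
  have h' : L.j y (L.j x y) = y := (L.j_assoc y x y).symm.trans h
  have ha : L.m y (L.j x y) = L.j x y := by
    simpa only [h'] using L.abs4 y (L.j x y)
  have hx : L.m (L.m x y) (L.j x y) = x := by
    rw [L.m_assoc, ha, L.abs1]
  calc L.m (L.m x y) x = L.m (L.m x y) (L.m (L.m x y) (L.j x y)) := by rw [hx]
    _ = x := by rw [← L.m_assoc, L.m_idem, hx]

theorem npre_join_join_iff : L.npre (L.j (L.j y x) y) y ↔ L.npre x y := by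
  have h : L.j (L.j y (L.j (L.j y x) y)) y = L.j (L.j y x) y := by
    simp only [L.j_assoc, L.j_idem]
    rw [← L.j_assoc y y, L.j_idem]
  unfold npre
  rw [h]

theorem nle_refl (x : S) : L.nle x x := ⟨L.j_idem x, L.j_idem x⟩

theorem nle.meet_eq_left (h : L.nle x y) : L.m x y = x := by
  simpa only [h.1] using L.abs1 x y

theorem nle.meet_eq_right (h : L.nle x y) : L.m y x = x := by
  simpa only [h.2] using L.abs4 y x

theorem nle.eq_of_npre (h : L.nle y x) (hxy : L.npre x y) : x = y := by
  rw [npre, h.1, h.2] at hxy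
  exact hxy

/-- In a co-strongly distributive skew lattice, upsets are closed under meets. -/
theorem CoStronglyDistributive.nle_meet (hcs : L.CoStronglyDistributive) {z : S}
    (hx : L.nle z x) (hy : L.nle z y) : L.nle z (L.m x y) :=
  ⟨by rw [hcs.1, hx.1, hy.1], by rw [hcs.2, hx.2, hy.2]⟩

end SkewLattice

open Classical in
/-- a co-strongly distributive skew chain with top is a skew Heyting
algebra via x→y = 1 if x ⪯ y, and y otherwise. -/
theorem stmt_16 {S : Type*} (L : SkewLattice S) (one : S)
    (hcs : L.CoStronglyDistributive) (htop : L.IsTop one)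
    (htotal : ∀ x y : S, L.npre x y ∨ L.npre y x) :
    L.IsSkewHeytingImp (fun x y => if L.npre x y then one else y) := by
  refine ⟨fun x y => by simp only [L.npre_join_join_iff], fun x y hyx => ?_⟩
  by_cases hxy : L.npre x y
  · obtain rfl := hyx.eq_of_npre L hxy
    simp only [if_pos hxy]
    refine ⟨htop x, ?_, fun w _ _ => htop w⟩
    rw [nle.meet_eq_right L (htop x)]
    exact L.nle_refl x
  · simp only [if_neg hxy]
    refine ⟨L.nle_refl y, ?_, fun w hyw hwx => ?_⟩
    · rw [hyx.meet_eq_left L]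
      exact L.nle_refl y
    · have hmeet : L.m w x = y := (hcs.nle_meet L hyw hyx).2.symm.trans hwx.1
      rcases htotal w x with h | h
      · have := h.meet_meet_eq L
        rw [hmeet, hyw.meet_eq_left L] at this
        rw [← this]
        exact L.nle_refl y
      · have := h.meet_meet_eq L
        rw [L.m_assoc, hmeet, hyx.meet_eq_right L] at this
        subst this
        exact absurd (by simp only [npre, L.j_idem]) hxy
end
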